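/- Let n > 2, let ξ : ℝⁿ → ℝⁿ be a smooth CKV of the flat Euclidean metric with conformal factor ψ such that ψ is harmonic (Δψ = 0), let a₀ ∈ ℝ, and let b : ℝⁿ → ℝ be harmonic. Then for every harmonic function u on ℝⁿ (Δu = 0), the function w = ((2−n)/2) ψ u + a₀ u + b − ξ^k ∂_k u is harmonic. (This is the evolutionary form of the statement that the Lie point symmetries of the Laplace equation are generated exactly by the CKVs whose conformal factor solves the Laplace equation; in particular Killing vectors, homothetic vectors and special CKVs always qualify.) -/

import Mathlib

/-- Partial derivative `∂f/∂xⁱ` of a function `f : ℝⁿ → ℝ`. -/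
noncomputable def pd {n : ℕ} (i : Fin n) (f : (Fin n → ℝ) → ℝ) : (Fin n → ℝ) → ℝ :=
  fun x => fderiv ℝ f x (Pi.single i 1)

/-- The flat Laplacian `Δf = Σ_i ∂²f/∂(xⁱ)²`. -/
noncomputable def lap {n : ℕ} (f : (Fin n → ℝ) → ℝ) : (Fin n → ℝ) → ℝ :=
  fun x => ∑ i, pd i (pd i f) x

theorem pd_smooth {n : ℕ} (i : Fin n) {f : (Fin n → ℝ) → ℝ} (hf : ContDiff ℝ (⊤ : ℕ∞) f) :
    ContDiff ℝ (⊤ : ℕ∞) (pd i f) := by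
  have h : ContDiff ℝ (⊤ : ℕ∞) (fderiv ℝ f) := hf.fderiv_right (by simp)
  exact h.clm_apply contDiff_const

theorem smooth_diff {n : ℕ} {f : (Fin n → ℝ) → ℝ} (hf : ContDiff ℝ (⊤ : ℕ∞) f) :
    Differentiable ℝ f := hf.differentiable (by simp)

theorem pd_add' {n : ℕ} (i : Fin n) {f g : (Fin n → ℝ) → ℝ} (hf : ContDiff ℝ (⊤ : ℕ∞) f)
    (hg : ContDiff ℝ (⊤ : ℕ∞) g) :
    pd i (fun x => f x + g x) = fun x => pd i f x + pd i g x := by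
  funext x
  simp only [pd]
  rw [fderiv_fun_add (smooth_diff hf x) (smooth_diff hg x)]
  rfl

theorem pd_mul' {n : ℕ} (i : Fin n) {f g : (Fin n → ℝ) → ℝ} (hf : ContDiff ℝ (⊤ : ℕ∞) f)
    (hg : ContDiff ℝ (⊤ : ℕ∞) g) :
    pd i (fun x => f x * g x) = fun x => f x * pd i g x + g x * pd i f x := by
  funext x
  simp only [pd]
  rw [fderiv_fun_mul (smooth_diff hf x) (smooth_diff hg x)]
  rfl

theorem pd_const' {n : ℕ} (i : Fin n) (c : ℝ) :
    pd i (fun _ : Fin n → ℝ => c) = fun _ => 0 := by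
  funext x
  simp [pd]

theorem pd_sum' {n : ℕ} {ι : Type} (s : Finset ι) (i : Fin n) {f : ι → (Fin n → ℝ) → ℝ}
    (hf : ∀ k, ContDiff ℝ (⊤ : ℕ∞) (f k)) :
    pd i (fun x => ∑ k ∈ s, f k x) = fun x => ∑ k ∈ s, pd i (f k) x := by
  funext x
  simp only [pd]
  rw [fderiv_fun_sum (fun k _ => smooth_diff (hf k) x)]
  simp

theorem pd_comm' {n : ℕ} (i j : Fin n) {f : (Fin n → ℝ) → ℝ} (hf : ContDiff ℝ (⊤ : ℕ∞) f) :
    pd i (pd j f) = pd j (pd i f) := by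
  funext x
  have h : ContDiff ℝ (⊤ : ℕ∞) (fderiv ℝ f) := hf.fderiv_right (by simp)
  have hd : DifferentiableAt ℝ (fderiv ℝ f) x := h.differentiable (by simp) x
  have key : ∀ a b : Fin n, pd a (pd b f) x
      = fderiv ℝ (fderiv ℝ f) x (Pi.single a 1) (Pi.single b 1) := by
    intro a b
    unfold pd
    rw [fderiv_clm_apply hd (differentiableAt_const _)]
    simp
  rw [key, key]
  have hs : IsSymmSndFDerivAt ℝ f x :=
    hf.contDiffAt.isSymmSndFDerivAt (by simp; exact WithTop.coe_le_coe.2 le_top)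
  exact hs _ _

theorem lap_add' {n : ℕ} {f g : (Fin n → ℝ) → ℝ} (hf : ContDiff ℝ (⊤ : ℕ∞) f)
    (hg : ContDiff ℝ (⊤ : ℕ∞) g) (x : Fin n → ℝ) :
    lap (fun x => f x + g x) x = lap f x + lap g x := by
  simp only [lap, ← Finset.sum_add_distrib]
  refine Finset.sum_congr rfl fun i _ => ?_
  rw [pd_add' i hf hg, pd_add' i (pd_smooth i hf) (pd_smooth i hg)]

theorem lap_mul' {n : ℕ} {f g : (Fin n → ℝ) → ℝ} (hf : ContDiff ℝ (⊤ : ℕ∞) f)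
    (hg : ContDiff ℝ (⊤ : ℕ∞) g) (x : Fin n → ℝ) :
    lap (fun x => f x * g x) x
      = f x * lap g x + g x * lap f x + 2 * ∑ i, pd i f x * pd i g x := by
  simp only [lap, Finset.mul_sum, ← Finset.sum_add_distrib]
  refine Finset.sum_congr rfl fun i _ => ?_
  have h1 := pd_smooth i hf
  have h2 := pd_smooth i hg
  rw [pd_mul' i hf hg, pd_add' i (hf.mul h2) (hg.mul h1), pd_mul' i hf h2, pd_mul' i hg h1]
  ring

theorem lap_cmul' {n : ℕ} (c : ℝ) {g : (Fin n → ℝ) → ℝ}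
    (hg : ContDiff ℝ (⊤ : ℕ∞) g) (x : Fin n → ℝ) :
    lap (fun x => c * g x) x = c * lap g x := by
  rw [lap_mul' contDiff_const hg]
  simp [lap, pd_const']

theorem lap_sum' {n : ℕ} {f : Fin n → (Fin n → ℝ) → ℝ}
    (hf : ∀ k, ContDiff ℝ (⊤ : ℕ∞) (f k)) (x : Fin n → ℝ) :
    lap (fun x => ∑ k, f k x) x = ∑ k, lap (f k) x := by
  simp only [lap]
  rw [Finset.sum_comm]
  refine Finset.sum_congr rfl fun i _ => ?_
  rw [pd_sum' _ i hf, pd_sum' _ i (fun k => pd_smooth i (hf k))]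

theorem lap_pd' {n : ℕ} (k : Fin n) {f : (Fin n → ℝ) → ℝ}
    (hf : ContDiff ℝ (⊤ : ℕ∞) f) :
    lap (pd k f) = pd k (lap f) := by
  unfold lap
  rw [pd_sum' _ k (fun i => pd_smooth i (pd_smooth i hf))]
  funext x
  refine Finset.sum_congr rfl fun i _ => ?_
  rw [pd_comm' i k hf, pd_comm' i k (pd_smooth i hf)]

/-- Lie point symmetries of the Laplace equation on ℝⁿ, `n > 2`, in
evolutionary form: if `ξ` is a flat CKV with harmonic conformal factor `ψ` and `b` is
harmonic, then for every harmonic `u` the function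
`w = ((2−n)/2) ψ u + a₀ u + b − ξ^k ∂_k u` is harmonic. -/
theorem stmt_7 {n : ℕ} (hn : 2 < n)
    (ξ : Fin n → (Fin n → ℝ) → ℝ) (ψ : (Fin n → ℝ) → ℝ)
    (hξ : ∀ i, ContDiff ℝ (⊤ : ℕ∞) (ξ i))
    (hckv : ∀ i j x, pd i (ξ j) x + pd j (ξ i) x =
      2 * ψ x * (if i = j then (1 : ℝ) else 0))
    (hψharm : ∀ x, lap ψ x = 0)
    (a₀ : ℝ) (b : (Fin n → ℝ) → ℝ) (hb : ContDiff ℝ (⊤ : ℕ∞) b)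
    (hbharm : ∀ x, lap b x = 0) :
    ∀ u : (Fin n → ℝ) → ℝ, ContDiff ℝ (⊤ : ℕ∞) u → (∀ x, lap u x = 0) →
      ∀ x, lap (fun y => ((2 - (n : ℝ)) / 2) * ψ y * u y + a₀ * u y + b y
        - ∑ k, ξ k y * pd k u y) x = 0 := by
  intro u hu hul x
  have hdiag : ∀ i, pd i (ξ i) = ψ := by
    intro i
    funext y
    have := hckv i i y
    simp at this
    linarith
  have hψ : ContDiff ℝ (⊤ : ℕ∞) ψ := by
    rw [← hdiag ⟨0, by omega⟩]
    exact pd_smooth _ (hξ _)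
  have hlξ : ∀ k, lap (ξ k) x = (2 - (n : ℝ)) * pd k ψ x := by
    intro k
    have h1 : ∀ i, pd i (pd i (ξ k)) x
        = 2 * (if i = k then (1 : ℝ) else 0) * pd i ψ x - pd k ψ x := by
      intro i
      have e : pd i (ξ k) = fun y => (2 * (if i = k then (1 : ℝ) else 0)) * ψ y
          + (-1) * pd k (ξ i) y := by
        funext y
        linarith [hckv i k y]
      rw [e, pd_add' i (contDiff_const.mul hψ) (contDiff_const.mul (pd_smooth k (hξ i))),
        pd_mul' i contDiff_const hψ, pd_mul' i contDiff_const (pd_smooth k (hξ i)),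
        pd_const', pd_const', pd_comm' i k (hξ i), hdiag]
      ring
    simp only [lap, h1, Finset.sum_sub_distrib]
    simp
    ring
  have hlu : lap u = fun _ => 0 := funext hul
  have hterm : ∀ k, ContDiff ℝ (⊤ : ℕ∞) (fun y => ξ k y * pd k u y) :=
    fun k => (hξ k).mul (pd_smooth k hu)
  have hsum : ContDiff ℝ (⊤ : ℕ∞) (fun y => ∑ k, ξ k y * pd k u y) :=
    ContDiff.sum fun k _ => hterm k
  have hcross : ∑ k, ∑ i, pd i (ξ k) x * pd i (pd k u) x = 0 := by
    have h2 : ∑ k, ∑ i, pd i (ξ k) x * pd i (pd k u) x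
        = ∑ k, ∑ i, pd k (ξ i) x * pd i (pd k u) x := by
      rw [Finset.sum_comm]
      refine Finset.sum_congr rfl fun i _ => Finset.sum_congr rfl fun k _ => ?_
      rw [pd_comm' i k hu]
    have h3 : ∑ k, ∑ i, pd i (ξ k) x * pd i (pd k u) x
        + ∑ k, ∑ i, pd k (ξ i) x * pd i (pd k u) x = 2 * ψ x * lap u x := by
      simp only [← Finset.sum_add_distrib, ← add_mul, hckv, lap, Finset.mul_sum]
      refine Finset.sum_congr rfl fun k _ => ?_
      simp
    rw [hul x] at h3
    linarith
  have hS : lap (fun y => ∑ k, ξ k y * pd k u y) x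
      = (2 - (n : ℝ)) * ∑ k, pd k ψ x * pd k u x := by
    rw [lap_sum' hterm]
    have h4 : ∀ k, lap (fun y => ξ k y * pd k u y) x
        = (2 - (n : ℝ)) * (pd k ψ x * pd k u x) + 2 * ∑ i, pd i (ξ k) x * pd i (pd k u) x := by
      intro k
      rw [lap_mul' (hξ k) (pd_smooth k hu), lap_pd' k hu, hlu, pd_const', hlξ]
      ring
    simp only [h4, Finset.sum_add_distrib, ← Finset.mul_sum, hcross]
    ring
  have e : (fun y => ((2 - (n : ℝ)) / 2) * ψ y * u y + a₀ * u y + b y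
        - ∑ k, ξ k y * pd k u y) = fun y => (((2 - (n : ℝ)) / 2) * (ψ y * u y) + a₀ * u y + b y)
        + (-1) * ∑ k, ξ k y * pd k u y := by
    funext y
    ring
  have c1 : ContDiff ℝ (⊤ : ℕ∞) (fun y => ((2 - (n : ℝ)) / 2) * (ψ y * u y)) :=
    contDiff_const.mul (hψ.mul hu)
  have c2 : ContDiff ℝ (⊤ : ℕ∞) (fun y => a₀ * u y) := contDiff_const.mul hu
  rw [e, lap_add' ((c1.add c2).add hb) (contDiff_const.mul hsum), lap_add' (c1.add c2) hb,
    lap_add' c1 c2, lap_cmul' _ (hψ.mul hu), lap_cmul' _ hu, lap_cmul' _ hsum, hS,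
    lap_mul' hψ hu, hul, hψharm, hbharm]
  ring
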